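/- arXiv:1906.05997 — 2 statements merged into one kernel-verified Lean document; each statement's English description precedes it below -/
import Mathlib

section
/- Let 1<p≤2. There is a constant c_p>0 depending only on p, b, c_+, c_- such that for every nonempty U⊂(0,∞), c_p · sup_{0<δ<1} 𝒦_p(U,δ) ≤ ‖𝓜^U‖_{L^p→L^p}, i.e. for every 0<δ<1 there exists a Schwartz function f with ‖𝓜^U f‖_{L^p(ℝ²)} ≥ c_p 𝒦_p(U,δ) ‖f‖_{L^p(ℝ²)}. -/
open MeasureTheory Filter Set Topology
open scoped ENNReal NNReal Topology Classical

noncomputable section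

/-- The homogeneous curve of degree `b`: `γ_b(t) = c₊ t^b` for `t > 0`,
`γ_b(t) = c₋ (-t)^b` for `t < 0`, `γ_b(0) = 0`. -/
def curve (b cp cm t : ℝ) : ℝ :=
  if 0 < t then cp * t ^ b else if t < 0 then cm * (-t) ^ b else 0

/-- The maximal function along the curve `(t, u γ_b(t))`. -/
def Mu (b cp cm u : ℝ) (f : ℝ × ℝ → ℝ) (x : ℝ × ℝ) : ℝ :=
  ⨆ R : {R : ℝ // 0 < R},
    ((R : ℝ))⁻¹ * ∫ t in (0:ℝ)..(R : ℝ), |f (x - (t, u * curve b cp cm t))|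

/-- The maximal function `𝓜^U f = sup_{u ∈ U} M^{(u)} f`. -/
def calM (b cp cm : ℝ) (U : Set ℝ) (f : ℝ × ℝ → ℝ) (x : ℝ × ℝ) : ℝ :=
  ⨆ u : U, Mu b cp cm (u : ℝ) f x

/-- The Hilbert transform along the curve `(t, u γ_b(t))` (principal value). -/
def Hu (b cp cm u : ℝ) (f : ℝ × ℝ → ℝ) (x : ℝ × ℝ) : ℝ :=
  limUnder (𝓝[>] (0:ℝ)) fun ε : ℝ =>
    ∫ t in {t : ℝ | ε < |t| ∧ |t| < ε⁻¹}, f (x - (t, u * curve b cp cm t)) / t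

/-- The maximal function `𝓗^U f = sup_{u ∈ U} |H^{(u)} f|`, valued in `ℝ≥0∞`. -/
def calH (b cp cm : ℝ) (U : Set ℝ) (f : ℝ × ℝ → ℝ) (x : ℝ × ℝ) : ℝ≥0∞ :=
  ⨆ u : U, ENNReal.ofReal |Hu b cp cm (u : ℝ) f x|

/-- The `L^p` norm of an `ℝ≥0∞`-valued function on `ℝ²`. -/
def lpN (g : ℝ × ℝ → ℝ≥0∞) (p : ℝ) : ℝ≥0∞ :=
  (∫⁻ x : ℝ × ℝ, g x ^ p) ^ (1 / p)

def eN (p : ℝ) : ℝ≥0∞ := ENNReal.ofReal p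

/-- `U^r = r⁻¹ U ∩ [1,2] = {ρ ∈ [1,2] : rρ ∈ U}`. -/
def UrSet (U : Set ℝ) (r : ℝ) : Set ℝ := {ρ : ℝ | ρ ∈ Icc (1:ℝ) 2 ∧ r * ρ ∈ U}

/-- `N(A,δ)`: minimal number of intervals of length `δ` needed to cover `A`. -/
def covN (A : Set ℝ) (δ : ℝ) : ℕ :=
  sInf {n : ℕ | ∃ F : Finset ℝ, F.card = n ∧ A ⊆ ⋃ a ∈ F, Icc a (a + δ)}

/-- `𝒦_p(U,δ) = δ^{1-1/p} sup_{r>0} N(U^r,δ)^{1/p}`. -/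
def Kp (U : Set ℝ) (δ p : ℝ) : ℝ :=
  δ ^ (1 - 1 / p) * ⨆ r : {r : ℝ // 0 < r}, ((covN (UrSet U (r : ℝ)) δ : ℝ)) ^ (1 / p)

/-- `p_cr(U) = 1 + limsup_{δ→0+} sup_{r>0} log N(U^r,δ) / log(1/δ)`. -/
def pcr (U : Set ℝ) : ℝ :=
  1 + limsup (fun δ : ℝ =>
      (⨆ r : {r : ℝ // 0 < r}, Real.log (covN (UrSet U (r : ℝ)) δ)) / Real.log δ⁻¹)
    (𝓝[>] (0:ℝ))

/-- `𝔑(U) = 1 + #{n ∈ ℤ : [2ⁿ, 2ⁿ⁺¹] ∩ U ≠ ∅}`. -/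
def frakN (U : Set ℝ) : ℕ∞ :=
  1 + Set.encard {n : ℤ | (Icc ((2:ℝ) ^ n) ((2:ℝ) ^ (n + 1)) ∩ U).Nonempty}

/-- `√(log 𝔑(U))`, valued in `ℝ≥0∞` (equal to `∞` if `𝔑(U) = ∞`). -/
def sqrtLogN (U : Set ℝ) : ℝ≥0∞ :=
  if frakN U = ⊤ then ⊤
  else ENNReal.ofReal (Real.sqrt (Real.log ((frakN U).toNat : ℝ)))

/-- The `L^p → L^p` operator norm of `𝓜^U` (smallest admissible constant, possibly `∞`). -/
def opNormM (b cp cm : ℝ) (U : Set ℝ) (p : ℝ) : ℝ≥0∞ :=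
  sInf {C : ℝ≥0∞ | ∀ f : SchwartzMap (ℝ × ℝ) ℝ,
    eLpNorm (calM b cp cm U ⇑f) (eN p) volume ≤ C * eLpNorm ⇑f (eN p) volume}

/-- The `L^p → L^p` operator norm of `𝓗^U` (smallest admissible constant, possibly `∞`). -/
def opNormH (b cp cm : ℝ) (U : Set ℝ) (p : ℝ) : ℝ≥0∞ :=
  sInf {C : ℝ≥0∞ | ∀ f : SchwartzMap (ℝ × ℝ) ℝ,
    lpN (calH b cp cm U ⇑f) p ≤ C * eLpNorm ⇑f (eN p) volume}

/-- `θ_{p,ℓ}`. -/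
def theta (p : ℝ) (l : ℕ) : ℝ :=
  if (l : ℝ) ≤ (p - 1)⁻¹ then (p - 1) ^ (3 - 10 / p) else (l : ℝ) ^ (7 * (2 / p - 1))

/-- `Σ_{ℓ≥1} θ_{p,ℓ} 𝒦_p(U, 2^{-ℓ})`, valued in `ℝ≥0∞`. -/
def KpSum (U : Set ℝ) (p : ℝ) : ℝ≥0∞ :=
  ∑' l : ℕ, ENNReal.ofReal (theta p (l + 1) * Kp U ((2:ℝ) ^ (-((l : ℝ) + 1))) p)



/-- A set of covering number `N` contains `δ`-separated finite subsets of any cardinality `k` with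
`2 * k ≤ N + 1`. -/
lemma exists_separated_of_le_covN {A : Set ℝ} {δ : ℝ} (hδ : 0 < δ) (k : ℕ)
    (hk : 2 * k ≤ covN A δ + 1) :
    ∃ S : Finset ℝ, S.card = k ∧ (∀ x ∈ S, x ∈ A) ∧ ∀ x ∈ S, ∀ y ∈ S, x ≠ y → δ < |x - y| := by
  induction k with
  | zero => exact ⟨∅, by simp⟩
  | succ k ih =>
    obtain ⟨S, hcard, hSA, hsep⟩ := ih (by omega)
    have hF : (S ∪ S.image (· - δ)).card < covN A δ := by
      have h1 := Finset.card_union_le S (S.image (· - δ))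
      have h2 : (S.image (· - δ)).card ≤ S.card := Finset.card_image_le
      omega
    have hcover : ¬ A ⊆ ⋃ a ∈ S ∪ S.image (· - δ), Icc a (a + δ) := fun h =>
      hF.not_ge (Nat.sInf_le ⟨_, rfl, h⟩)
    obtain ⟨x, hxA, hx⟩ := Set.not_subset.1 hcover
    have hfar : ∀ y ∈ S, δ < |x - y| := by
      intro y hy
      by_contra! h
      rw [abs_le] at h
      apply hx
      rw [Set.mem_iUnion₂]
      rcases le_total y x with hyx | hyx
      · exact ⟨y, by simp [hy], hyx, by linarith⟩
      · exact ⟨y - δ, Finset.mem_union_right _ (Finset.mem_image_of_mem _ hy),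
          by linarith, by linarith⟩
    have hxS : x ∉ S := fun h => by
      have := hfar x h
      simp at this
      linarith
    refine ⟨insert x S, by rw [Finset.card_insert_of_notMem hxS, hcard], ?_, ?_⟩
    · simpa [hxA] using hSA
    · intro y hy z hz hyz
      rcases Finset.mem_insert.1 hy with rfl | hyS <;> rcases Finset.mem_insert.1 hz with rfl | hzS
      · exact absurd rfl hyz
      · exact hfar z hzS
      · rw [abs_sub_comm]; exact hfar y hyS
      · exact hsep y hyS z hzS hyz

lemma abs_rpow_sub_rpow_le {b s t : ℝ} (hb : 1 < b) (ht : 0 ≤ t) (hts : t ≤ s) (hs : s ≤ 2) :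
    |s ^ b - t ^ b| ≤ b * 2 ^ (b - 1) * |s - t| := by
  refine (convex_Icc (0 : ℝ) 2).norm_image_sub_le_of_norm_hasDerivWithin_le
    (f := fun x : ℝ => x ^ b) (f' := fun x => b * x ^ (b - 1))
    (fun x _ => (Real.hasDerivAt_rpow_const (Or.inr hb.le)).hasDerivWithinAt) (fun x hx => ?_)
    ⟨ht, hts.trans hs⟩ ⟨ht.trans hts, hs⟩
  have h0 : 0 ≤ x ^ (b - 1) := Real.rpow_nonneg hx.1 _
  rw [Real.norm_eq_abs, abs_of_nonneg (by positivity)]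
  exact mul_le_mul_of_nonneg_left (Real.rpow_le_rpow hx.1 hx.2 (by linarith)) (by linarith)

lemma measurable_curve (b cp cm : ℝ) : Measurable (curve b cp cm) := by
  unfold curve
  refine Measurable.ite measurableSet_Ioi (by fun_prop) (Measurable.ite measurableSet_Iio ?_ ?_)
  all_goals fun_prop

lemma average_le_one {b cp cm u R : ℝ} {f : ℝ × ℝ → ℝ} (hf : ∀ x, |f x| ≤ 1) (x : ℝ × ℝ)
    (hR : 0 < R) :
    R⁻¹ * ∫ t in (0:ℝ)..R, |f (x - (t, u * curve b cp cm t))| ≤ 1 := by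
  have h := intervalIntegral.norm_integral_le_of_norm_le_const (a := 0) (b := R) (C := 1)
    (f := fun t => |f (x - (t, u * curve b cp cm t))|)
    (fun t _ => by simpa using hf _)
  rw [sub_zero, one_mul, abs_of_pos hR] at h
  calc _ ≤ R⁻¹ * R := by gcongr; exact (le_abs_self _).trans h
    _ = 1 := inv_mul_cancel₀ hR.ne'

/-- A single average bounds the maximal function of a bounded function from below. -/
lemma average_le_calM {b cp cm u R : ℝ} {U : Set ℝ} {f : ℝ × ℝ → ℝ} (hf : ∀ x, |f x| ≤ 1)
    (hu : u ∈ U) (hR : 0 < R) (x : ℝ × ℝ) :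
    R⁻¹ * ∫ t in (0:ℝ)..R, |f (x - (t, u * curve b cp cm t))| ≤ calM b cp cm U f x := by
  have : Nonempty {R : ℝ // 0 < R} := ⟨⟨R, hR⟩⟩
  have h1 : R⁻¹ * ∫ t in (0:ℝ)..R, |f (x - (t, u * curve b cp cm t))| ≤ Mu b cp cm u f x :=
    le_ciSup (f := fun R : {R : ℝ // 0 < R} =>
      (R : ℝ)⁻¹ * ∫ t in (0:ℝ)..(R : ℝ), |f (x - (t, u * curve b cp cm t))|)
      ⟨1, by rintro _ ⟨R, rfl⟩; exact average_le_one hf x R.2⟩ ⟨R, hR⟩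
  have h2 : Mu b cp cm u f x ≤ calM b cp cm U f x :=
    le_ciSup (f := fun u : U => Mu b cp cm (u : ℝ) f x)
      ⟨1, by rintro _ ⟨v, rfl⟩; exact ciSup_le fun R => average_le_one hf x R.2⟩ ⟨u, hu⟩
  exact h1.trans h2

/-- The average over `[0, 2]` is at least `δ / 2` if the function equals `1` along the curve on an
interval of length `δ`. -/
lemma half_le_average {b cp cm u δ : ℝ} {f : ℝ × ℝ → ℝ} (hf : ∀ x, |f x| ≤ 1)
    (hfc : Continuous f) {x : ℝ × ℝ} (hδ : 0 < δ) (hx : δ ≤ x.1) (hx2 : x.1 ≤ 2)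
    (h : ∀ t ∈ Ioc (x.1 - δ) x.1, f (x - (t, u * curve b cp cm t)) = 1) :
    δ / 2 ≤ (2:ℝ)⁻¹ * ∫ t in (0:ℝ)..2, |f (x - (t, u * curve b cp cm t))| := by
  have hmeas : Measurable fun t => |f (x - (t, u * curve b cp cm t))| := by
    have := measurable_curve b cp cm
    have := hfc.measurable
    fun_prop
  have hint : IntegrableOn (fun t => |f (x - (t, u * curve b cp cm t))|) (Ioc 0 2) :=
    IntegrableOn.of_bound (by simp) hmeas.aestronglyMeasurable 1
      (Eventually.of_forall fun t => by simpa using hf _)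
  have hsub : Ioc (x.1 - δ) x.1 ⊆ Ioc 0 2 := Ioc_subset_Ioc (by linarith) hx2
  have h1 := setIntegral_ge_of_const_le_real (c := 1) measurableSet_Ioc (by simp)
    (fun t ht => by simp [h t ht]) (hint.mono_set hsub)
  have h2 := setIntegral_mono_set hint (Eventually.of_forall fun t => abs_nonneg _)
    (LE.le.eventuallyLE hsub)
  rw [intervalIntegral.integral_of_le (by norm_num)]
  have h3 : volume.real (Ioc (x.1 - δ) x.1) = δ := by
    rw [Real.volume_real_Ioc_of_le (by linarith)]; ring
  rw [h3] at h1
  linarith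

/-- A Schwartz function adapted to a rectangle. -/
lemma exists_schwartz_rectangle {l h : ℝ} (hl : 0 < l) (hh : 0 < h) :
    ∃ f : SchwartzMap (ℝ × ℝ) ℝ, (∀ x, |f x| ≤ 1) ∧
      (∀ x : ℝ × ℝ, |x.1| ≤ l → |x.2| ≤ h → f x = 1) ∧
      ∀ x, x ∉ Icc (-(2 * l)) (2 * l) ×ˢ Icc (-(2 * h)) (2 * h) → f x = 0 := by
  let φ : ContDiffBump (0 : ℝ) := ⟨l, 2 * l, hl, by linarith⟩
  let ψ : ContDiffBump (0 : ℝ) := ⟨h, 2 * h, hh, by linarith⟩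
  let g : ℝ × ℝ → ℝ := fun x => φ x.1 * ψ x.2
  have hzero : ∀ x, x ∉ Icc (-(2 * l)) (2 * l) ×ˢ Icc (-(2 * h)) (2 * h) → g x = 0 := by
    intro x hx
    rw [Set.mem_prod, not_and_or] at hx
    rcases hx with hx | hx
    · have : φ x.1 = 0 := φ.zero_of_le_dist (by
        rw [dist_zero_right, Real.norm_eq_abs]
        by_contra! hlt
        exact hx (abs_le.1 hlt.le))
      simp [g, this]
    · have : ψ x.2 = 0 := ψ.zero_of_le_dist (by
        rw [dist_zero_right, Real.norm_eq_abs]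
        by_contra! hlt
        exact hx (abs_le.1 hlt.le))
      simp [g, this]
  have hsupp : HasCompactSupport g :=
    HasCompactSupport.intro (isCompact_Icc.prod isCompact_Icc) fun x hx => hzero x hx
  have hsmooth : ContDiff ℝ ((⊤ : ℕ∞) : WithTop ℕ∞) g :=
    (φ.contDiff.comp contDiff_fst).mul (ψ.contDiff.comp contDiff_snd)
  refine ⟨hsupp.toSchwartzMap hsmooth, fun x => ?_, fun x hx hy => ?_, fun x hx => hzero x hx⟩
  · change |φ x.1 * ψ x.2| ≤ 1
    rw [abs_of_nonneg (mul_nonneg φ.nonneg ψ.nonneg)]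
    exact mul_le_one₀ φ.le_one ψ.nonneg ψ.le_one
  · change φ x.1 * ψ x.2 = 1
    rw [φ.one_of_mem_closedBall (by simpa using hx), ψ.one_of_mem_closedBall (by simpa using hy),
      one_mul]

/-- The open strip of vertical width `w` around the curve `(t, s t^b)`, `1 ≤ t ≤ 2`. -/
def curveStrip (b s w : ℝ) : Set (ℝ × ℝ) :=
  regionBetween (fun t => s * t ^ b - w / 2) (fun t => s * t ^ b + w / 2) (Icc 1 2)

lemma measurableSet_curveStrip (b s w : ℝ) : MeasurableSet (curveStrip b s w) :=
  measurableSet_regionBetween (by fun_prop) (by fun_prop) measurableSet_Icc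

lemma volume_curveStrip (b s w : ℝ) : volume (curveStrip b s w) = ENNReal.ofReal w := by
  rw [curveStrip, Measure.volume_eq_prod, volume_regionBetween_eq_lintegral
    (by fun_prop) (by fun_prop) measurableSet_Icc]
  have : ∀ y : ℝ, ((fun t => s * t ^ b + w / 2) - (fun t => s * t ^ b - w / 2) : ℝ → ℝ) y = w := by
    intro y; simp only [Pi.sub_apply]; ring
  simp only [this, setLIntegral_const, Real.volume_Icc]
  norm_num

lemma disjoint_curveStrip {b s s' w : ℝ} (hb : 1 < b) (h : w ≤ |s - s'|) :
    Disjoint (curveStrip b s w) (curveStrip b s' w) := by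
  rw [Set.disjoint_left]
  rintro ⟨t, y⟩ ⟨ht, hy1, hy2⟩ ⟨-, hy3, hy4⟩
  have h1 : 1 ≤ t ^ b := Real.one_le_rpow ht.1 (by linarith)
  have h2 : |s - s'| * t ^ b < w := by
    rw [← abs_of_pos (zero_lt_one.trans_le h1), ← abs_mul, abs_lt]
    simp only at hy1 hy2 hy3 hy4
    constructor <;> nlinarith
  nlinarith [abs_nonneg (s - s')]

/-- Lower bound for the maximal function near the curves. -/
lemma le_calM_of_mem_curveStrip {b cp cm r δ ρ : ℝ} (hb : 1 < b) {U : Set ℝ} (hr : 0 < r)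
    (hδ : 0 < δ) (hδ1 : δ < 1) (hρ : ρ ∈ UrSet U r) {f : ℝ × ℝ → ℝ} (hf : ∀ x, |f x| ≤ 1)
    (hfc : Continuous f)
    (hf1 : ∀ x : ℝ × ℝ, |x.1| ≤ δ →
      |x.2| ≤ |cp| * (1 + 2 * (b * 2 ^ (b - 1))) * r * δ → f x = 1)
    {x : ℝ × ℝ} (hx : x ∈ curveStrip b (r * ρ * cp) (r * |cp| * δ)) :
    δ / 2 ≤ calM b cp cm U f x := by
  obtain ⟨⟨hx1, hx2⟩, hy1, hy2⟩ := hx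
  refine (half_le_average hf hfc hδ (by linarith) hx2 fun t ht => ?_).trans
    (average_le_calM hf hρ.2 two_pos x)
  have ht0 : 0 < t := by linarith [ht.1]
  have hcurve : curve b cp cm t = cp * t ^ b := by simp [curve, ht0]
  have hpow := abs_rpow_sub_rpow_le hb ht0.le ht.2 hx2
  have hdist : |x.1 - t| ≤ δ := by
    rw [abs_le]; constructor <;> linarith [ht.1, ht.2]
  refine hf1 _ hdist ?_
  have hu : |r * ρ * cp| ≤ r * 2 * |cp| := by
    rw [abs_mul, abs_mul, abs_of_pos hr, abs_of_pos (zero_lt_one.trans_le hρ.1.1)]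
    gcongr
    exact hρ.1.2
  have hdiff : |r * ρ * cp * (x.1 ^ b - t ^ b)| ≤ r * 2 * |cp| * (b * 2 ^ (b - 1) * δ) := by
    rw [abs_mul]
    gcongr
    exact hpow.trans (by gcongr)
  have hnear : |x.2 - r * ρ * cp * x.1 ^ b| ≤ r * |cp| * δ := by
    have : 0 < r * |cp| * δ := by linarith
    rw [abs_le]; constructor <;> linarith
  have hsplit : (x - (t, r * ρ * curve b cp cm t)).2
      = (x.2 - r * ρ * cp * x.1 ^ b) + r * ρ * cp * (x.1 ^ b - t ^ b) := by
    rw [hcurve, Prod.snd_sub]; ring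
  rw [hsplit]
  refine (abs_add_le _ _).trans ((add_le_add hnear hdiff).trans (le_of_eq ?_))
  ring

lemma rpow_bound_of_admissible {b cp cm p r δ : ℝ} (hb : 1 < b) (hcp : cp ≠ 0) (hp : 1 < p)
    {U : Set ℝ} (hr : 0 < r) (hδ : 0 < δ) (hδ1 : δ < 1) {C : ℝ} (hC0 : 0 ≤ C)
    (hC : ∀ f : SchwartzMap (ℝ × ℝ) ℝ, eLpNorm (calM b cp cm U ⇑f) (eN p) volume
      ≤ ENNReal.ofReal C * eLpNorm ⇑f (eN p) volume) {S : Finset ℝ} (hS : ∀ ρ ∈ S, ρ ∈ UrSet U r)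
    (hsep : ∀ x ∈ S, ∀ y ∈ S, x ≠ y → δ < |x - y|) :
    δ / 2 * (S.card * (r * |cp| * δ)) ^ (1 / p)
      ≤ C * (16 * (|cp| * (1 + 2 * (b * 2 ^ (b - 1)))) * r * δ ^ 2) ^ (1 / p) := by
  have hcp' : 0 < |cp| := abs_pos.2 hcp
  have hp0 : 0 < p := by linarith
  have hpow : (0:ℝ) < 2 ^ (b - 1) := by positivity
  set A := |cp| * (1 + 2 * (b * 2 ^ (b - 1))) with hA
  have hA0 : 0 < A := by positivity
  obtain ⟨f, hf, hf1, hf0⟩ := exists_schwartz_rectangle hδ (h := A * r * δ) (by positivity)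
  have hpN : eN p ≠ 0 := by simp [eN, hp0]
  have hpT : eN p ≠ ∞ := ENNReal.ofReal_ne_top
  have hpR : (eN p).toReal = p := ENNReal.toReal_ofReal hp0.le
  set E : Set (ℝ × ℝ) := ⋃ ρ ∈ S, curveStrip b (r * ρ * cp) (r * |cp| * δ) with hE
  have hEmeas : MeasurableSet E :=
    Finset.measurableSet_biUnion _ fun ρ _ => measurableSet_curveStrip _ _ _
  have hEvol : volume E = ENNReal.ofReal (S.card * (r * |cp| * δ)) := by
    rw [hE, measure_biUnion_finset ?_ fun ρ _ => measurableSet_curveStrip _ _ _]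
    · simp only [volume_curveStrip, Finset.sum_const, nsmul_eq_mul]
      rw [ENNReal.ofReal_mul (Nat.cast_nonneg _), ENNReal.ofReal_natCast]
    · intro x hx y hy hxy
      refine disjoint_curveStrip hb ?_
      have := hsep x hx y hy hxy
      rw [← sub_mul, ← mul_sub, abs_mul, abs_mul, abs_of_pos hr]
      calc r * |cp| * δ ≤ r * |cp| * |x - y| := by gcongr
        _ = _ := by ring
  have hlow : ENNReal.ofReal (δ / 2 * (S.card * (r * |cp| * δ)) ^ (1 / p))
      ≤ eLpNorm (calM b cp cm U ⇑f) (eN p) volume := by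
    have h1 : eLpNorm (E.indicator fun _ => δ / 2) (eN p) volume
        ≤ eLpNorm (calM b cp cm U ⇑f) (eN p) volume := by
      refine eLpNorm_mono fun x => ?_
      by_cases hx : x ∈ E
      · rw [Set.indicator_of_mem hx, Real.norm_eq_abs, abs_of_pos (by positivity)]
        obtain ⟨ρ, hρ, hxρ⟩ := Set.mem_iUnion₂.1 hx
        exact (le_calM_of_mem_curveStrip hb hr hδ hδ1 (hS ρ hρ) hf f.continuous hf1 hxρ).trans
          (le_abs_self _)
      · simp [Set.indicator_of_notMem hx]
    rw [eLpNorm_indicator_const hEmeas hpN hpT, hEvol, hpR,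
      ENNReal.ofReal_rpow_of_nonneg (by positivity) (by positivity),
      Real.enorm_of_nonneg (by positivity), ← ENNReal.ofReal_mul (by positivity)] at h1
    exact h1
  have hup : eLpNorm ⇑f (eN p) volume ≤ ENNReal.ofReal ((16 * A * r * δ ^ 2) ^ (1 / p)) := by
    set K : Set (ℝ × ℝ) :=
      Icc (-(2 * δ)) (2 * δ) ×ˢ Icc (-(2 * (A * r * δ))) (2 * (A * r * δ)) with hK
    have hKvol : volume K = ENNReal.ofReal (16 * A * r * δ ^ 2) := by
      rw [hK, Measure.volume_eq_prod, Measure.prod_prod, Real.volume_Icc, Real.volume_Icc,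
        ← ENNReal.ofReal_mul (by linarith)]
      congr 1; ring
    have h1 : eLpNorm ⇑f (eN p) volume ≤ eLpNorm (K.indicator fun _ => (1:ℝ)) (eN p) volume := by
      refine eLpNorm_mono_real fun x => ?_
      by_cases hx : x ∈ K
      · rw [Set.indicator_of_mem hx]; exact hf x
      · simp [Set.indicator_of_notMem hx, hf0 x hx]
    rw [eLpNorm_indicator_const (measurableSet_Icc.prod measurableSet_Icc) hpN hpT, hKvol, hpR,
      ENNReal.ofReal_rpow_of_nonneg (by positivity) (by positivity), enorm_one, one_mul] at h1
    exact h1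
  have hfin := (hlow.trans (hC f)).trans (mul_le_mul_right hup _)
  rw [← ENNReal.ofReal_mul hC0] at hfin
  exact (ENNReal.ofReal_le_ofReal_iff (by positivity)).1 hfin

theorem statement2 (b cp cm : ℝ) (hb : 1 < b) (hcp : cp ≠ 0) (hcm : cm ≠ 0) (p : ℝ) (hp1 : 1 < p) (hp2 : p ≤ 2) :
    ∃ c : ℝ, 0 < c ∧ ∀ U : Set ℝ, U.Nonempty → U ⊆ Ioi (0:ℝ) →
      ENNReal.ofReal c *
          (⨆ δ : {δ : ℝ // 0 < δ ∧ δ < 1}, ENNReal.ofReal (Kp U (δ : ℝ) p))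
        ≤ opNormM b cp cm U p := by
  have hcp' : 0 < |cp| := abs_pos.2 hcp
  have hpow : (0:ℝ) < 2 ^ (b - 1) := by positivity
  set A := |cp| * (1 + 2 * (b * 2 ^ (b - 1))) with hA
  have hA0 : 0 < A := by positivity
  have hp0 : 0 < p := by linarith
  refine ⟨1 / 2 * (|cp| / (32 * A)) ^ (1 / p), by positivity, fun U _ _ => le_sInf fun C hC => ?_⟩
  rcases eq_or_ne C ∞ with rfl | hCtop
  · exact le_top
  obtain ⟨D, hD0, rfl⟩ : ∃ D : ℝ, 0 ≤ D ∧ C = ENNReal.ofReal D :=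
    ⟨C.toReal, ENNReal.toReal_nonneg, (ENNReal.ofReal_toReal hCtop).symm⟩
  rw [ENNReal.mul_iSup]
  refine iSup_le fun ⟨δ, hδ, hδ1⟩ => ?_
  rw [← ENNReal.ofReal_mul (by positivity)]
  refine ENNReal.ofReal_le_ofReal ?_
  rw [Kp, ← mul_assoc, Real.mul_iSup_of_nonneg (by positivity)]
  refine Real.iSup_le (fun ⟨r, hr⟩ => ?_) hD0
  set N := covN (UrSet U r) δ with hN
  obtain ⟨S, hcard, hS, hsep⟩ := exists_separated_of_le_covN hδ (A := UrSet U r) ((N + 1) / 2)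
    (by omega)
  have hNS : (N : ℝ) / 2 ≤ S.card := by
    have : N ≤ 2 * S.card := by omega
    have : (N : ℝ) ≤ 2 * S.card := by exact_mod_cast this
    linarith
  have hmain := rpow_bound_of_admissible hb hcp hp1 hr hδ hδ1 hD0 hC hS hsep
  rw [← hA] at hmain
  refine le_of_mul_le_mul_right (le_trans ?_ hmain)
    (show 0 < (16 * A * r * δ ^ 2) ^ (1 / p) by positivity)
  have hδp : δ ^ (1 - 1 / p) = δ * (δ⁻¹) ^ (1 / p) := by
    rw [Real.rpow_sub hδ, Real.rpow_one, Real.inv_rpow hδ.le, div_eq_mul_inv]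
  calc 1 / 2 * (|cp| / (32 * A)) ^ (1 / p) * δ ^ (1 - 1 / p) * (N : ℝ) ^ (1 / p)
        * (16 * A * r * δ ^ 2) ^ (1 / p)
      = δ / 2 * ((|cp| / (32 * A)) ^ (1 / p) * (δ⁻¹) ^ (1 / p) * (N : ℝ) ^ (1 / p)
        * (16 * A * r * δ ^ 2) ^ (1 / p)) := by rw [hδp]; ring
    _ = δ / 2 * ((N : ℝ) / 2 * (r * |cp| * δ)) ^ (1 / p) := by
      rw [← Real.mul_rpow (by positivity) (by positivity),
        ← Real.mul_rpow (by positivity) (by positivity),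
        ← Real.mul_rpow (by positivity) (by positivity)]
      congr 2
      field_simp
      ring
    _ ≤ δ / 2 * (S.card * (r * |cp| * δ)) ^ (1 / p) := by gcongr

end
end

section
/- Let 1<p≤2 and let U⊂(0,∞) be nonempty. If p<p_cr(U), then 𝓗^U is not bounded on L^p(ℝ²): there is no finite constant C with ‖𝓗^U f‖_{L^p(ℝ²)} ≤ C‖f‖_{L^p(ℝ²)} for all Schwartz functions f on ℝ². -/
open MeasureTheory Filter Set Topology
open scoped ENNReal NNReal Topology Classical

noncomputable section

/-- The power function is Lipschitz on `[1/2, 5/2]`. -/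
lemma exists_rpow_lipschitz (b : ℝ) : ∃ L : ℝ, 0 < L ∧
    ∀ s ∈ Icc (1 / 2 : ℝ) (5 / 2), ∀ t ∈ Icc (1 / 2 : ℝ) (5 / 2),
      |t ^ b - s ^ b| ≤ L * |t - s| := by
  have hne : ∀ x ∈ Icc (1 / 2 : ℝ) (5 / 2), x ≠ 0 := fun x hx => by
    have := hx.1
    intro h
    norm_num [h] at this
  have hc : ContinuousOn (fun x : ℝ => b * x ^ (b - 1)) (Icc (1 / 2 : ℝ) (5 / 2)) :=
    continuousOn_const.mul fun x hx =>
      (Real.continuousAt_rpow_const x _ (Or.inl (hne x hx))).continuousWithinAt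
  obtain ⟨L, hL⟩ := isCompact_Icc.exists_bound_of_continuousOn hc
  refine ⟨max L 1, by positivity, fun s hs t ht => ?_⟩
  exact (convex_Icc (1 / 2 : ℝ) (5 / 2)).norm_image_sub_le_of_norm_hasDerivWithin_le
    (f' := fun x : ℝ => b * x ^ (b - 1))
    (fun x hx => (Real.hasDerivAt_rpow_const (Or.inl (hne x hx))).hasDerivWithinAt)
    (fun x hx => (hL x hx).trans (le_max_left _ _)) hs ht

lemma finite_floor_image {A : Set ℝ} (hA : A ⊆ Icc 1 2) {η : ℝ} (hη : 0 < η) :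
    ((fun ρ : ℝ => ⌊ρ / η⌋) '' A).Finite := by
  refine (Set.finite_Icc (0 : ℤ) ⌊2 / η⌋).subset ?_
  rintro _ ⟨ρ, hρ, rfl⟩
  have h := hA hρ
  refine ⟨Int.floor_nonneg.2 (div_nonneg (by linarith [h.1]) hη.le), Int.floor_mono ?_⟩
  have := h.2
  gcongr

lemma covN_le_ncard_floor_image {A : Set ℝ} (hA : A ⊆ Icc 1 2) {η : ℝ} (hη : 0 < η) :
    covN A η ≤ ((fun ρ : ℝ => ⌊ρ / η⌋) '' A).ncard := by
  have hf := finite_floor_image hA hη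
  have hcov : covN A η ≤ (hf.toFinset.image fun k : ℤ => (k : ℝ) * η).card := by
    refine Nat.sInf_le ⟨_, rfl, fun ρ hρ => ?_⟩
    refine mem_iUnion₂.2 ⟨(⌊ρ / η⌋ : ℝ) * η, ?_, ?_, ?_⟩
    · exact Finset.mem_image.2 ⟨_, hf.mem_toFinset.2 ⟨ρ, hρ, rfl⟩, rfl⟩
    · exact (le_div_iff₀ hη).1 (Int.floor_le _)
    · have := (div_lt_iff₀ hη).1 (Int.lt_floor_add_one (ρ / η))
      linarith
  refine hcov.trans (Finset.card_image_le.trans ?_)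
  rw [Set.ncard_eq_toFinset_card _ hf]

lemma volume_floor_mem {J : Set ℤ} (hJ : J.Finite) :
    volume {z : ℝ | ⌊z⌋ ∈ J} = (J.ncard : ℝ≥0∞) := by
  have h : {z : ℝ | ⌊z⌋ ∈ J} = ⋃ k ∈ hJ.toFinset, Ico (k : ℝ) (k + 1) := by
    ext z
    simp only [mem_iUnion₂, Set.mem_ofPred_eq, hJ.mem_toFinset, mem_Ico, ← Int.floor_eq_iff]
    exact ⟨fun hz => ⟨_, hz, rfl⟩, fun ⟨_, hk, hz⟩ => hz ▸ hk⟩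
  rw [h, measure_biUnion_finset]
  · simp [Set.ncard_eq_toFinset_card _ hJ]
  · intro i _ j _ hij
    refine Set.disjoint_left.2 fun z hi hj => hij ?_
    rw [← Int.floor_eq_iff.2 hi, ← Int.floor_eq_iff.2 hj]
  · exact fun _ _ => measurableSet_Ico

/-- The union of the strips `x₂ / a(x₁) ∈ [k, k + 1)`, `k ∈ J`, over `1 ≤ x₁ ≤ 2`. -/
def strips (a : ℝ → ℝ) (J : Set ℤ) : Set (ℝ × ℝ) :=
  {x | x.1 ∈ Icc (1 : ℝ) 2 ∧ ⌊x.2 / a x.1⌋ ∈ J}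

lemma measurableSet_strips {a : ℝ → ℝ} (ha : Measurable a) (J : Set ℤ) :
    MeasurableSet (strips a J) := by
  refine (measurableSet_Icc.preimage measurable_fst).inter ?_
  have : Measurable fun x : ℝ × ℝ => ⌊x.2 / a x.1⌋ := by fun_prop
  exact this (MeasurableSet.of_discrete (s := J))

lemma le_volume_strips {a : ℝ → ℝ} (ha : Measurable a) {J : Set ℤ} (hJ : J.Finite) {m : ℝ}
    (hm : 0 < m) (hma : ∀ t ∈ Icc (1 : ℝ) 2, m ≤ |a t|) :
    ENNReal.ofReal m * J.ncard ≤ volume (strips a J) := by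
  rw [Measure.volume_eq_prod, Measure.prod_apply (measurableSet_strips ha J)]
  calc ENNReal.ofReal m * J.ncard
      = ∫⁻ _ in Icc (1 : ℝ) 2, ENNReal.ofReal m * J.ncard := by
        norm_num [lintegral_const]
    _ ≤ ∫⁻ t in Icc (1 : ℝ) 2, volume (Prod.mk t ⁻¹' strips a J) := by
        refine setLIntegral_mono' measurableSet_Icc fun t ht => ?_
        have h : Prod.mk t ⁻¹' strips a J = (fun y => y * (a t)⁻¹) ⁻¹' {z : ℝ | ⌊z⌋ ∈ J} := by
          ext y
          simp only [strips, Set.mem_preimage, Set.mem_ofPred_eq, ht, true_and, div_eq_mul_inv]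
        have hat : a t ≠ 0 := abs_pos.1 (hm.trans_le (hma t ht))
        rw [h, Real.volume_preimage_mul_right (inv_ne_zero hat), inv_inv, volume_floor_mem hJ]
        gcongr
        exact hma t ht
    _ ≤ _ := setLIntegral_le_lintegral _ _

/-- The smooth bump adapted to the rectangle `[-δ, δ] × [-ε, ε]`. -/
lemma exists_schwartz_bump {δ ε : ℝ} (hδ : 0 < δ) (hε : 0 < ε) :
    ∃ f : SchwartzMap (ℝ × ℝ) ℝ, (∀ x, 0 ≤ f x) ∧ (∀ x, f x ≤ 1) ∧
      (∀ x : ℝ × ℝ, |x.1| ≤ δ → |x.2| ≤ ε → f x = 1) ∧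
      (∀ x : ℝ × ℝ, f x ≠ 0 → |x.1| ≤ 2 * δ ∧ |x.2| ≤ 2 * ε) := by
  let φ : ContDiffBump (0 : ℝ) := ⟨δ, 2 * δ, hδ, by linarith⟩
  let ψ : ContDiffBump (0 : ℝ) := ⟨ε, 2 * ε, hε, by linarith⟩
  have hsupp : ∀ x : ℝ × ℝ, φ x.1 * ψ x.2 ≠ 0 → |x.1| ≤ 2 * δ ∧ |x.2| ≤ 2 * ε := by
    intro x hx
    constructor
    · by_contra! h
      exact hx (by rw [φ.zero_of_le_dist (by simpa [φ] using h.le), zero_mul])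
    · by_contra! h
      exact hx (by rw [ψ.zero_of_le_dist (by simpa [ψ] using h.le), mul_zero])
  have hc : HasCompactSupport fun x : ℝ × ℝ => φ x.1 * ψ x.2 := by
    refine HasCompactSupport.intro
      (isCompact_Icc (a := ((-(2 * δ), -(2 * ε)) : ℝ × ℝ)) (b := (2 * δ, 2 * ε))) fun x hx => ?_
    by_contra h
    obtain ⟨h1, h2⟩ := hsupp x h
    rw [abs_le] at h1 h2
    exact hx ⟨⟨h1.1, h2.1⟩, ⟨h1.2, h2.2⟩⟩
  have hd : ContDiff ℝ ((⊤ : ℕ∞) : WithTop ℕ∞) fun x : ℝ × ℝ => φ x.1 * ψ x.2 :=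
    (φ.contDiff.comp contDiff_fst).mul (ψ.contDiff.comp contDiff_snd)
  refine ⟨hc.toSchwartzMap hd, fun x => ?_, fun x => ?_, fun x h1 h2 => ?_, hsupp⟩
  · exact mul_nonneg φ.nonneg ψ.nonneg
  · exact mul_le_one₀ φ.le_one ψ.nonneg ψ.le_one
  · change φ x.1 * ψ x.2 = 1
    rw [φ.one_of_mem_closedBall (by simpa [φ] using h1),
      ψ.one_of_mem_closedBall (by simpa [ψ] using h2), mul_one]

/-- For `f` adapted to a small rectangle, `H^{(u)} f` is large near the curve. -/
lemma le_Hu_of_near_curve {b cp cm L κ δ r u : ℝ} {x : ℝ × ℝ} {f : ℝ × ℝ → ℝ}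
    (hL : ∀ s ∈ Icc (1 / 2 : ℝ) (5 / 2), ∀ t ∈ Icc (1 / 2 : ℝ) (5 / 2),
      |t ^ b - s ^ b| ≤ L * |t - s|)
    (hκ : 0 < κ) (hκ1 : κ ≤ 1) (hκL : 2 * |cp| * L * κ ≤ 1 / 2) (hL0 : 0 < L)
    (hδ : 0 < δ) (hδ1 : δ ≤ 1 / 8) (hu : 0 < u) (hur : u ≤ 2 * r)
    (hf : Continuous f) (hf0 : ∀ y, 0 ≤ f y) (hf1 : ∀ y, f y ≤ 1)
    (hfone : ∀ y : ℝ × ℝ, |y.1| ≤ δ → |y.2| ≤ r * δ → f y = 1)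
    (hfsupp : ∀ y : ℝ × ℝ, f y ≠ 0 → |y.1| ≤ 2 * δ)
    (hx1 : x.1 ∈ Icc (1 : ℝ) 2) (hx2 : |x.2 - u * (cp * x.1 ^ b)| ≤ r * δ / 2) :
    κ * δ / 2 ≤ Hu b cp cm u f x := by
  set g : ℝ → ℝ := fun t => f (x - (t, u * curve b cp cm t)) / t with hg
  have hr : 0 < r := by linarith
  have hgsupp : ∀ t, g t ≠ 0 → 3 / 4 ≤ t ∧ t ≤ 9 / 4 := by
    intro t ht
    have h := hfsupp (x - (t, u * curve b cp cm t)) fun h0 => ht (by simp [hg, h0])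
    simp only [Prod.fst_sub, abs_le] at h
    constructor <;> linarith [hx1.1, hx1.2, h.1, h.2]
  have hgm : Measurable g := by
    have := measurable_curve b cp cm
    have h2 : Measurable fun t : ℝ => x - (t, u * curve b cp cm t) := by fun_prop
    exact (hf.measurable.comp h2).div measurable_id
  have hgi : Integrable g := by
    refine Integrable.mono' (g := (Icc (3 / 4 : ℝ) (9 / 4)).indicator fun _ => (2 : ℝ))
      (IntegrableOn.integrable_indicator (by simp) measurableSet_Icc) hgm.aestronglyMeasurable
      (ae_of_all _ fun t => ?_)
    by_cases ht : g t = 0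
    · rw [ht, norm_zero]
      exact indicator_nonneg (fun _ _ => by norm_num) _
    · obtain ⟨h1, h2⟩ := hgsupp t ht
      rw [indicator_of_mem (show t ∈ Icc (3 / 4 : ℝ) (9 / 4) from ⟨h1, h2⟩), Real.norm_eq_abs,
        abs_of_nonneg (div_nonneg (hf0 _) (by linarith)), div_le_iff₀ (by linarith)]
      linarith [hf1 (x - (t, u * curve b cp cm t))]
  have hlim : Hu b cp cm u f x = ∫ t, g t := by
    refine Tendsto.limUnder_eq (tendsto_const_nhds.congr' ?_)
    have hev : ∀ᶠ ε : ℝ in 𝓝[>] (0 : ℝ), ε ∈ Ioo (0 : ℝ) (1 / 4) :=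
      Ioo_mem_nhdsGT (by norm_num)
    filter_upwards [hev] with ε hε
    refine (setIntegral_eq_integral_of_forall_compl_eq_zero fun t ht => ?_).symm
    by_contra h
    obtain ⟨h1, h2⟩ := hgsupp t h
    refine ht ⟨?_, ?_⟩
    · rw [abs_of_pos (by linarith)]
      linarith [hε.2]
    · rw [abs_of_pos (by linarith), lt_inv_comm₀ (by linarith) hε.1]
      refine hε.2.trans_le ?_
      rw [le_inv_comm₀ (by norm_num) (by linarith)]
      linarith
  rw [hlim]
  have hind : (Icc (x.1 - κ * δ) (x.1 + κ * δ)).indicator (fun _ => (1 / 3 : ℝ)) ≤ g := by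
    intro t
    by_cases ht : t ∈ Icc (x.1 - κ * δ) (x.1 + κ * δ)
    · rw [indicator_of_mem ht]
      have hκδ : κ * δ ≤ δ := mul_le_of_le_one_left hδ.le hκ1
      have hdist : |t - x.1| ≤ κ * δ := abs_le.2 ⟨by linarith [ht.1], by linarith [ht.2]⟩
      have htI : t ∈ Icc (1 / 2 : ℝ) (5 / 2) :=
        ⟨by linarith [ht.1, hx1.1], by linarith [ht.2, hx1.2]⟩
      have hxI : x.1 ∈ Icc (1 / 2 : ℝ) (5 / 2) := ⟨by linarith [hx1.1], by linarith [hx1.2]⟩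
      have ht0 : 0 < t := by linarith [htI.1]
      have hLip := hL x.1 hxI t htI
      have h1 : f (x - (t, u * curve b cp cm t)) = 1 := by
        refine hfone _ ?_ ?_
        · simp only [Prod.fst_sub]
          rw [abs_sub_comm]
          exact hdist.trans hκδ
        · simp only [Prod.snd_sub, curve, if_pos ht0]
          have e : x.2 - u * (cp * t ^ b)
              = (x.2 - u * (cp * x.1 ^ b)) - u * cp * (t ^ b - x.1 ^ b) := by ring
          rw [e]
          refine (abs_sub _ _).trans ?_
          have h3 : |u * cp * (t ^ b - x.1 ^ b)| ≤ r * δ / 2 := by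
            rw [abs_mul, abs_mul, abs_of_pos hu]
            calc u * |cp| * |t ^ b - x.1 ^ b|
                ≤ (2 * r) * |cp| * (L * (κ * δ)) := by
                  gcongr
                  exact hLip.trans (by gcongr)
              _ = (2 * |cp| * L * κ) * (r * δ) := by ring
              _ ≤ 1 / 2 * (r * δ) := by gcongr
              _ = r * δ / 2 := by ring
          linarith
      simp only [hg, h1]
      exact one_div_le_one_div_of_le ht0 (by linarith [htI.2])
    · rw [indicator_of_notMem ht]
      by_cases h0 : g t = 0
      · exact h0.ge
      · exact div_nonneg (hf0 _) (by linarith [(hgsupp t h0).1])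
  calc κ * δ / 2 ≤ 2 * (κ * δ) * (1 / 3) := by nlinarith [mul_pos hκ hδ]
    _ = ∫ t, (Icc (x.1 - κ * δ) (x.1 + κ * δ)).indicator (fun _ => (1 / 3 : ℝ)) t := by
        rw [integral_indicator_const _ measurableSet_Icc, Real.volume_real_Icc_of_le
          (by nlinarith [mul_pos hκ hδ]), smul_eq_mul]
        ring
    _ ≤ ∫ t, g t := integral_mono
        (IntegrableOn.integrable_indicator (by simp) measurableSet_Icc) hgi hind

/-- A function bounded by `1` and supported in a rectangle has controlled `L^p` norm. -/
lemma eLpNorm_le_of_support {f : ℝ × ℝ → ℝ} {δ ε p : ℝ} (hp : 0 < p)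
    (hf0 : ∀ y, 0 ≤ f y) (hf1 : ∀ y, f y ≤ 1)
    (hfsupp : ∀ y : ℝ × ℝ, f y ≠ 0 → |y.1| ≤ 2 * δ ∧ |y.2| ≤ 2 * ε) :
    eLpNorm f (eN p) volume ≤
      (ENNReal.ofReal (4 * δ) * ENNReal.ofReal (4 * ε)) ^ (1 / p) := by
  set S : Set (ℝ × ℝ) := Icc (-(2 * δ)) (2 * δ) ×ˢ Icc (-(2 * ε)) (2 * ε) with hS
  have hle : ∀ y, ‖f y‖ ≤ S.indicator (fun _ => (1 : ℝ)) y := by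
    intro y
    by_cases h : f y = 0
    · rw [h, norm_zero]
      exact indicator_nonneg (fun _ _ => zero_le_one) _
    · obtain ⟨h1, h2⟩ := hfsupp y h
      have hy : y ∈ S := ⟨abs_le.1 h1, abs_le.1 h2⟩
      rw [indicator_of_mem hy, Real.norm_of_nonneg (hf0 y)]
      exact hf1 y
  refine (eLpNorm_mono_real hle).trans ?_
  have hp0 : eN p ≠ 0 := by simpa [eN] using hp
  rw [eLpNorm_indicator_const (measurableSet_Icc.prod measurableSet_Icc) hp0
    ENNReal.ofReal_ne_top, eN, ENNReal.toReal_ofReal hp.le, Measure.volume_eq_prod,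
    Measure.prod_prod, Real.volume_Icc, Real.volume_Icc, enorm_one, one_mul]
  ring_nf
  rfl

/-- A bound for `𝓗^U` on `L^p` bounds `N(U^r, η) η^{p-1}` uniformly in small `η` and in `r`. -/
lemma exists_covN_bound {b cp cm : ℝ} (hb : 1 < b) (hcp : cp ≠ 0) {U : Set ℝ}
    {p : ℝ} (hp1 : 1 < p) {C : ℝ}
    (hC : ∀ f : SchwartzMap (ℝ × ℝ) ℝ,
      lpN (calH b cp cm U ⇑f) p ≤ ENNReal.ofReal C * eLpNorm ⇑f (eN p) volume) :
    ∃ η₀ D : ℝ, 0 < η₀ ∧ ∀ η, 0 < η → η ≤ η₀ → ∀ r, 0 < r →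
      (covN (UrSet U r) η : ℝ) * η ^ (p - 1) ≤ D := by
  obtain ⟨L, hL0, hL⟩ := exists_rpow_lipschitz b
  have hc : 0 < |cp| := abs_pos.2 hcp
  have hp0 : 0 < p := by linarith
  set C' : ℝ := max C 0 with hC'
  have hC0 : 0 ≤ C' := le_max_right _ _
  set κ : ℝ := min 1 (1 / (4 * |cp| * L)) with hκ
  have hκ0 : 0 < κ := by positivity
  have hκL : 2 * |cp| * L * κ ≤ 1 / 2 := by
    calc 2 * |cp| * L * κ ≤ 2 * |cp| * L * (1 / (4 * |cp| * L)) := by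
          gcongr
          exact min_le_right _ _
      _ = 1 / 2 := by field_simp; norm_num
  set K : ℝ := 2 * |cp| * 2 ^ b with hK
  have hK0 : 0 < K := by positivity
  refine ⟨1 / (8 * K), C' ^ p * (16 * K ^ 2) / ((κ * K / 2) ^ p * |cp|), by positivity,
    fun η hη hη₀ r hr => ?_⟩
  set δ : ℝ := K * η with hδ
  have hδ0 : 0 < δ := by positivity
  have hδ1 : δ ≤ 1 / 8 := by
    calc K * η ≤ K * (1 / (8 * K)) := by gcongr
      _ = 1 / 8 := by field_simp
  obtain ⟨f, hf0, hf1, hfone, hfsupp⟩ := exists_schwartz_bump hδ0 (mul_pos hr hδ0)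
  have hA : UrSet U r ⊆ Icc 1 2 := fun ρ hρ => hρ.1
  set J : Set ℤ := (fun ρ : ℝ => ⌊ρ / η⌋) '' UrSet U r with hJ
  have hJf : J.Finite := finite_floor_image hA hη
  set a : ℝ → ℝ := fun t => r * cp * t ^ b * η with ha
  have ham : Measurable a := by fun_prop
  have habs : ∀ t ∈ Icc (1 : ℝ) 2, |a t| = r * |cp| * t ^ b * η := fun t ht => by
    rw [ha]
    simp only [abs_mul, abs_of_pos hr, abs_of_pos hη,
      abs_of_nonneg (Real.rpow_nonneg (zero_le_one.trans ht.1) b)]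
  have hlow : ∀ x ∈ strips a J,
      ENNReal.ofReal (κ * δ / 2) ≤ calH b cp cm U f x := by
    rintro x ⟨hx1, ρ, hρ, hfl⟩
    have hρ12 := hA hρ
    have hx1b : (0 : ℝ) < x.1 ^ b := Real.rpow_pos_of_pos (by linarith [hx1.1]) b
    have ha0 : 0 < |a x.1| := by
      rw [habs _ hx1]
      positivity
    have hnear : |x.2 - r * ρ * (cp * x.1 ^ b)| ≤ r * δ / 2 := by
      have h1 : |x.2 / a x.1 - ρ / η| < 1 := Int.abs_sub_lt_one_of_floor_eq_floor hfl.symm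
      have e : x.2 - r * ρ * (cp * x.1 ^ b) = (x.2 / a x.1 - ρ / η) * a x.1 := by
        rw [sub_mul, div_mul_cancel₀ _ (abs_pos.1 ha0), ha]
        field_simp
      rw [e, abs_mul]
      calc |x.2 / a x.1 - ρ / η| * |a x.1| ≤ 1 * |a x.1| := by gcongr
        _ = r * |cp| * x.1 ^ b * η := by rw [one_mul, habs _ hx1]
        _ ≤ r * |cp| * 2 ^ b * η := by
            have h2 := hx1.2
            have h0 : (0 : ℝ) ≤ x.1 := by linarith [hx1.1]
            gcongr
        _ = r * δ / 2 := by rw [hδ, hK]; ring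
    have hu : 0 < r * ρ := mul_pos hr (by linarith [hρ12.1])
    have hH := le_Hu_of_near_curve (cm := cm) hL hκ0 (min_le_left _ _) hκL hL0 hδ0 hδ1 hu
      (by nlinarith [hρ12.2]) f.continuous hf0 hf1 hfone (fun y hy => (hfsupp y hy).1) hx1 hnear
    exact (ENNReal.ofReal_le_ofReal (hH.trans (le_abs_self _))).trans
      (le_iSup (fun u : U => ENNReal.ofReal |Hu b cp cm (u : ℝ) f x|) ⟨r * ρ, hρ.2⟩)
  have hvol : ENNReal.ofReal (r * |cp| * η) * J.ncard ≤ volume (strips a J) := by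
    refine le_volume_strips ham hJf (by positivity) fun t ht => ?_
    rw [habs t ht]
    have : 1 ≤ t ^ b := Real.one_le_rpow ht.1 (by linarith)
    calc r * |cp| * η = r * |cp| * 1 * η := by ring
      _ ≤ _ := by gcongr
  have hint : ENNReal.ofReal (κ * δ / 2) ^ p * (ENNReal.ofReal (r * |cp| * η) * J.ncard)
      ≤ ∫⁻ x, calH b cp cm U f x ^ p := by
    calc _ ≤ ENNReal.ofReal (κ * δ / 2) ^ p * volume (strips a J) := by gcongr
      _ = ∫⁻ _ in strips a J, ENNReal.ofReal (κ * δ / 2) ^ p := (setLIntegral_const _ _).symm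
      _ ≤ ∫⁻ x in strips a J, calH b cp cm U f x ^ p :=
          setLIntegral_mono' (measurableSet_strips ham J) fun x hx => by
            gcongr
            exact hlow x hx
      _ ≤ _ := setLIntegral_le_lintegral _ _
  have hup : ∫⁻ x, calH b cp cm U f x ^ p ≤
      ENNReal.ofReal C' ^ p * (ENNReal.ofReal (4 * δ) * ENNReal.ofReal (4 * (r * δ))) := by
    have h1 : lpN (calH b cp cm U f) p ≤ ENNReal.ofReal C' *
        (ENNReal.ofReal (4 * δ) * ENNReal.ofReal (4 * (r * δ))) ^ (1 / p) :=
      (hC f).trans (mul_le_mul' (ENNReal.ofReal_le_ofReal (le_max_left _ _))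
        (eLpNorm_le_of_support hp0 hf0 hf1 hfsupp))
    have h2 := ENNReal.rpow_le_rpow h1 hp0.le
    rwa [lpN, ENNReal.mul_rpow_of_nonneg _ _ hp0.le, ← ENNReal.rpow_mul, ← ENNReal.rpow_mul,
      one_div_mul_cancel hp0.ne', ENNReal.rpow_one, ENNReal.rpow_one] at h2
  have hreal : (κ * δ / 2) ^ p * (r * |cp| * η * J.ncard) ≤
      C' ^ p * (4 * δ * (4 * (r * δ))) := by
    have h := hint.trans hup
    rw [ENNReal.ofReal_rpow_of_nonneg (by positivity) hp0.le,
      ENNReal.ofReal_rpow_of_nonneg hC0 hp0.le, ← ENNReal.ofReal_natCast,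
      ← ENNReal.ofReal_mul (by positivity), ← ENNReal.ofReal_mul (by positivity),
      ← ENNReal.ofReal_mul (by positivity), ← ENNReal.ofReal_mul (by positivity)] at h
    exact (ENNReal.ofReal_le_ofReal_iff (by positivity)).1 h
  have hcov : (covN (UrSet U r) η : ℝ) ≤ J.ncard := by
    exact_mod_cast covN_le_ncard_floor_image hA hη
  rw [le_div_iff₀ (by positivity)]
  have e1 : (κ * δ / 2) ^ p = (κ * K / 2) ^ p * (η ^ (p - 1) * η) := by
    rw [show κ * δ / 2 = κ * K / 2 * η by rw [hδ]; ring,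
      Real.mul_rpow (by positivity) hη.le, ← Real.rpow_add_one hη.ne', sub_add_cancel]
  refine le_of_mul_le_mul_right (a := r * η ^ 2) ?_ (by positivity)
  calc (covN (UrSet U r) η : ℝ) * η ^ (p - 1) * ((κ * K / 2) ^ p * |cp|) * (r * η ^ 2)
      ≤ J.ncard * η ^ (p - 1) * ((κ * K / 2) ^ p * |cp|) * (r * η ^ 2) := by gcongr
    _ = (κ * δ / 2) ^ p * (r * |cp| * η * J.ncard) := by rw [e1]; ring
    _ ≤ C' ^ p * (4 * δ * (4 * (r * δ))) := hreal
    _ = C' ^ p * (16 * K ^ 2) * (r * η ^ 2) := by rw [hδ]; ring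

theorem statement5 (b cp cm : ℝ) (hb : 1 < b) (hcp : cp ≠ 0) (hcm : cm ≠ 0)
    (U : Set ℝ) (hUne : U.Nonempty) (hUsub : U ⊆ Ioi (0:ℝ)) (p : ℝ) (hp1 : 1 < p) (hp2 : p ≤ 2) (hpcr : p < pcr U) :
    ¬ ∃ C : ℝ, ∀ f : SchwartzMap (ℝ × ℝ) ℝ,
      lpN (calH b cp cm U ⇑f) p ≤ ENNReal.ofReal C * eLpNorm ⇑f (eN p) volume := by
  rintro ⟨C, hC⟩
  obtain ⟨η₀, D, hη₀, hD⟩ := exists_covN_bound hb hcp hp1 hC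
  obtain ⟨q, hpq, hq⟩ := exists_between (show p - 1 < pcr U - 1 by linarith)
  have hev01 : ∀ᶠ η : ℝ in 𝓝[>] (0 : ℝ), η ∈ Ioo (0 : ℝ) 1 := Ioo_mem_nhdsGT one_pos
  have hcob : IsCoboundedUnder (· ≤ ·) (𝓝[>] (0 : ℝ)) fun δ : ℝ =>
      (⨆ r : {r : ℝ // 0 < r}, Real.log (covN (UrSet U (r : ℝ)) δ)) / Real.log δ⁻¹ := by
    refine IsCoboundedUnder.of_frequently_ge (a := 0) (Eventually.frequently ?_)
    filter_upwards [hev01] with η hη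
    refine div_nonneg (Real.iSup_nonneg fun _ => Real.log_natCast_nonneg _) ?_
    exact Real.log_nonneg ((one_le_inv₀ hη.1).2 hη.2.le)
  have hfreq := frequently_lt_of_lt_limsup hcob (show q < _ by
    rw [pcr, add_sub_cancel_left] at hq
    exact hq)
  have hlarge : ∀ᶠ η : ℝ in 𝓝[>] (0 : ℝ), D < η ^ (-(q - (p - 1))) :=
    (tendsto_rpow_neg_nhdsGT_zero (by linarith)).eventually_gt_atTop D
  obtain ⟨η, hηq, ⟨⟨hη0, hη1⟩, hηD⟩, -, hηη₀⟩ := (hfreq.and_eventually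
    ((hev01.and hlarge).and (Ioo_mem_nhdsGT hη₀))).exists
  have hlog : 0 < Real.log η⁻¹ := Real.log_pos ((one_lt_inv₀ hη0).2 hη1)
  rw [lt_div_iff₀ hlog] at hηq
  obtain ⟨⟨r, hr⟩, hlt⟩ := exists_lt_of_lt_ciSup hηq
  have hcov : 0 < (covN (UrSet U r) η : ℝ) := by
    rcases Nat.eq_zero_or_pos (covN (UrSet U r) η) with h | h
    · simp only [h, Nat.cast_zero, Real.log_zero] at hlt
      nlinarith
    · exact_mod_cast h
  have hgt : η ^ (-q) < covN (UrSet U r) η := by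
    rw [Real.rpow_def_of_pos hη0, ← Real.lt_log_iff_exp_lt hcov]
    rw [Real.log_inv] at hlt
    calc Real.log η * -q = q * -Real.log η := by ring
      _ < _ := hlt
  have hmul := mul_lt_mul_of_pos_right hgt (Real.rpow_pos_of_pos hη0 (p - 1))
  rw [← Real.rpow_add hη0, show -q + (p - 1) = -(q - (p - 1)) by ring] at hmul
  exact absurd (hD η hη0 hηη₀.le r hr) (not_le.2 (hηD.trans hmul))

end
end
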